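/- arXiv:2406.17240 — 4 statements merged into one kernel-verified Lean document; each statement's English description precedes it below -/
import Mathlib

section
/- Let A be an oPG and i an entrance of A. Then i is pending if and only if for every T ∈ Pr(A, i) one has ⊤ ∉ T and ⊥ ∉ T, and for all (o1, m1), (o2, m2) ∈ T, if o1 = o2 then m1 = m2. -/
open scoped Classical

/-! ## Priorities and the sub-priority order -/

/-- The sub-priority order `⪯_P` on natural-number priorities:
`m1 ⪯_P m2` iff (both odd and `m2 ≤ m1`) or (`m1` odd and `m2` even)
or (both even and `m1 ≤ m2`). -/
def SubPrio (m1 m2 : ℕ) : Prop :=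
  (Odd m1 ∧ Odd m2 ∧ m2 ≤ m1) ∨ (Odd m1 ∧ Even m2) ∨ (Even m1 ∧ Even m2 ∧ m1 ≤ m2)

/-- The dual `m†` of a priority. -/
def dualP (m : ℕ) : ℕ := if m % 2 = 1 then m + 1 else if m = 0 then 0 else m - 1

/-! ## (Open) parity games -/

/-- A raw parity game over the node type `V`: node ownership (`eve v = true`
means `v` is owned by Player ∃), the edge relation, and the priority labelling. -/
structure PreGame (V : Type) where
  eve : V → Bool
  E : V → V → Prop
  Ω : V → V → ℕ

/-- A raw open parity game: a parity game together with lists of rightward and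
leftward entrances and exits. -/
structure PreOPG (V : Type) extends PreGame V where
  Iright : List V
  Ileft : List V
  Oright : List V
  Oleft : List V

variable {V W : Type}

/-- The entrances of an open parity game. -/
def PreOPG.ent (A : PreOPG V) : List V := A.Iright ++ A.Ileft

/-- The exits of an open parity game. -/
def PreOPG.exits (A : PreOPG V) : List V := A.Oright ++ A.Oleft

/-- Well-formedness of an open parity game (with maximal priority `M`). -/
structure OPGwf (M : ℕ) (A : PreOPG V) : Prop where
  nonempty : Nonempty V
  finite : Finite V
  succ : ∀ v, ∃ v', A.E v v'
  prio_le : ∀ v v', A.E v v' → A.Ω v v' ≤ M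
  ends_eve : ∀ v ∈ A.ent ++ A.exits, A.eve v = true
  ends_nodup : (A.ent ++ A.exits).Nodup
  exit_sink : ∀ o ∈ A.exits, ∀ v, A.E o v → v = o
  exit_self : ∀ o ∈ A.exits, A.E o o ∧ A.Ω o o = 0

/-! ## Strategies and plays -/

/-- An ∃-strategy: given the strict history and the current node (together a
finite path ending in the current node), pick a successor; it must follow
edges at nodes owned by Player ∃. -/
def IsEStrat (G : PreGame V) (σ : List V → V → V) : Prop :=
  ∀ h v, G.eve v = true → G.E v (σ h v)

/-- A ∀-strategy. -/
def IsAStrat (G : PreGame V) (σ : List V → V → V) : Prop :=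
  ∀ h v, G.eve v = false → G.E v (σ h v)

/-- A strategy is positional if it only depends on the last node of the path. -/
def Positional (σ : List V → V → V) : Prop := ∀ h h' v, σ h v = σ h' v

/-- The pair (strict history, current node) after `n` steps of the play
from `v` induced by the strategies `σe, σa`. -/
def playPath (G : PreGame V) (σe σa : List V → V → V) (v : V) : ℕ → List V × V
  | 0 => ([], v)
  | n + 1 =>
      let hc := playPath G σe σa v n
      (hc.1 ++ [hc.2], if G.eve hc.2 then σe hc.1 hc.2 else σa hc.1 hc.2)

/-- The play from `v` induced by the strategies `σe, σa`. -/
def playSeq (G : PreGame V) (σe σa : List V → V → V) (v : V) (n : ℕ) : V :=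
  (playPath G σe σa v n).2

/-- The parity condition: the maximum priority occurring infinitely often
along the play is even. -/
def PlayWins (G : PreGame V) (p : ℕ → V) : Prop :=
  ∃ m, Even m ∧ (∃ᶠ j in Filter.atTop, G.Ω (p j) (p (j + 1)) = m) ∧
    ∀ m', (∃ᶠ j in Filter.atTop, G.Ω (p j) (p (j + 1)) = m') → m' ≤ m

/-- A node of a parity game is winning (for Player ∃) if some ∃-strategy beats
every ∀-strategy from that node. -/
def WinningNode (G : PreGame V) (v : V) : Prop :=
  ∃ σe, IsEStrat G σe ∧ ∀ σa, IsAStrat G σa → PlayWins G (playSeq G σe σa v)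

/-! ## The domain of an open parity game and denotations -/

/-- The carrier of the domain `D(A) = {⊥, ⊤} ∪ (O × ℙ)` of an oPG. -/
inductive Dom (V : Type) where
  | bot : Dom V
  | top : Dom V
  | ex : V → ℕ → Dom V

/-- The domain order `⪯_D`. -/
def DomLE (d1 d2 : Dom V) : Prop :=
  d1 = Dom.bot ∨ d2 = Dom.top ∨
    ∃ o m1 m2, d1 = Dom.ex o m1 ∧ d2 = Dom.ex o m2 ∧ SubPrio m1 m2

/-- Membership in the domain `D(A)` (exit points carry exits of `A` and
priorities bounded by `M`). -/
def InDom (M : ℕ) (A : PreOPG V) (d : Dom V) : Prop :=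
  ∀ o m, d = Dom.ex o m → o ∈ A.exits ∧ m ≤ M

/-- Mapping domain elements along a renaming of exits. -/
def Dom.map (f : V → W) : Dom V → Dom W
  | .bot => .bot
  | .top => .top
  | .ex o m => .ex (f o) m

/-- The denotation of a play, as a relation: `PlayDen A p d` holds iff `⟦p⟧ = d`. -/
def PlayDen (A : PreOPG V) (p : ℕ → V) (d : Dom V) : Prop :=
  (∃ j, p j ∈ A.exits ∧ (∀ k, k < j → p k ∉ A.exits) ∧
      d = Dom.ex (p j) ((Finset.range j).sup fun k => A.Ω (p k) (p (k + 1)))) ∨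
  ((∀ j, p j ∉ A.exits) ∧ PlayWins A.toPreGame p ∧ d = Dom.top) ∨
  ((∀ j, p j ∉ A.exits) ∧ ¬ PlayWins A.toPreGame p ∧ d = Dom.bot)

/-- `{ ⟦play(σe, σa, i)⟧ : σa a ∀-strategy }`. -/
def denSet (A : PreOPG V) (σe : List V → V → V) (i : V) : Set (Dom V) :=
  { d | ∃ σa, IsAStrat A.toPreGame σa ∧ PlayDen A (playSeq A.toPreGame σe σa i) d }

/-- `Min(T)`: the set of `⪯_D`-minimal elements of `T`. -/
def minSet (T : Set (Dom V)) : Set (Dom V) :=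
  { d | d ∈ T ∧ ∀ d' ∈ T, DomLE d' d → d' = d }

/-- The upper preorder `⪯_U` on subsets of the domain. -/
def UpLE (T1 T2 : Set (Dom V)) : Prop := ∀ d2 ∈ T2, ∃ d1 ∈ T1, DomLE d1 d2

/-- `Max(S)`: the set of `⪯_U`-maximal elements of `S`. -/
def maxSets (S : Set (Set (Dom V))) : Set (Set (Dom V)) :=
  { T | T ∈ S ∧ ∀ T' ∈ S, UpLE T T' → UpLE T' T }

/-- The Pareto front `Pr(A, i)` of an oPG `A` at an entrance `i`. -/
def pareto (A : PreOPG V) (i : V) : Set (Set (Dom V)) :=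
  maxSets { T | ∃ σe, IsEStrat A.toPreGame σe ∧ T = minSet (denSet A σe i) }

/-- The denotation `⟦i⟧` of an entrance `i`. -/
def denEntrance (A : PreOPG V) (i : V) : Set (Set (Dom V)) :=
  { T | ∃ σe, IsEStrat A.toPreGame σe ∧ T = denSet A σe i }

/-- The entrance `i` is winning if `{⊤} ∈ ⟦i⟧`. -/
def WinningEnt (A : PreOPG V) (i : V) : Prop :=
  ({Dom.top} : Set (Dom V)) ∈ denEntrance A i

/-- The entrance `i` is losing if `⊥ ∈ T` for every `T ∈ ⟦i⟧`. -/
def LosingEnt (A : PreOPG V) (i : V) : Prop :=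
  ∀ T ∈ denEntrance A i, Dom.bot ∈ T

/-- The entrance `i` is pending if it is neither winning nor losing. -/
def PendingEnt (A : PreOPG V) (i : V) : Prop :=
  ¬ WinningEnt A i ∧ ¬ LosingEnt A i

/-- A result: a nonempty antichain in the domain `D(A)`. -/
def IsResult (M : ℕ) (A : PreOPG V) (r : Set (Dom V)) : Prop :=
  r.Nonempty ∧ minSet r = r ∧ ∀ d ∈ r, InDom M A d

/-! ## Queries, duals and the loop construction -/

/-- A query assigns to each exit a priority or `⊥` (`none`);
well-formedness: its priority values on exits are bounded by `M`. -/
def QueryWF (M : ℕ) (A : PreOPG V) (q : V → Option ℕ) : Prop :=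
  ∀ o ∈ A.exits, ∀ m, q o = some m → m ≤ M

/-- Equality of queries (as functions on the exits). -/
def QueryEq (A : PreOPG V) (q q' : V → Option ℕ) : Prop :=
  ∀ o ∈ A.exits, q o = q' o

/-- The (pointwise) query order. -/
def QueryLE (A : PreOPG V) (q q' : V → Option ℕ) : Prop :=
  ∀ o ∈ A.exits, q o = none ∨ ∃ m m', q o = some m ∧ q' o = some m' ∧ SubPrio m m'

/-- The dual `A(q)` of a query `q`. -/
def queryDual (A : PreOPG V) (q : V → Option ℕ) : Set (Dom V) :=
  { d | ((∀ o ∈ A.exits, q o = none) ∧ d = Dom.top) ∨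
        (∃ o ∈ A.exits, ∃ m, q o = some m ∧ d = Dom.ex o (dualP m)) }

/-- The loop construction `L(A, i, q)`: keep all edges not leaving an exit;
from each exit `o` with `q o = some m` add an edge to `i` with priority `m`;
from each exit `o` with `q o = none` add a self-loop with priority `1`. -/
noncomputable def loopPG (A : PreOPG V) (i : V) (q : V → Option ℕ) : PreGame V where
  eve := A.eve
  E := fun v v' =>
    (A.E v v' ∧ v ∉ A.exits) ∨
    (v ∈ A.exits ∧ (∃ m, q v = some m) ∧ v' = i) ∨
    (v ∈ A.exits ∧ q v = none ∧ v' = v)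
  Ω := fun v v' =>
    if v ∈ A.exits then (match q v with | some m => m | none => 1) else A.Ω v v'

/-! ## The shortcut construction -/

/-- The shortcut oPG `S(A)`: its nodes are the open ends of `A` (owned by
Player ∃) together with one ∀-node `(i, r)` for each entrance `i` and each
Pareto-optimal result `r ∈ Pr(A, i)`. -/
noncomputable def shortcut (A : PreOPG V) : PreOPG (V ⊕ (V × Set (Dom V))) where
  eve := fun x => match x with | .inl _ => true | .inr _ => false
  E := fun x y => match x, y with
    | .inl v, .inr (i, r) => v = i ∧ i ∈ A.ent ∧ r ∈ pareto A i
    | .inr (i, r), .inl o => i ∈ A.ent ∧ r ∈ pareto A i ∧ ∃ m, Dom.ex o m ∈ r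
    | .inl o, .inl o' => o ∈ A.exits ∧ o' = o
    | .inr (i, r), .inr (i', r') =>
        i = i' ∧ r = r' ∧ i ∈ A.ent ∧ r ∈ pareto A i ∧ (Dom.top ∈ r ∨ Dom.bot ∈ r)
  Ω := fun x y => match x, y with
    | .inl _, _ => 0
    | .inr (_, r), .inl o => sSup { m | Dom.ex o m ∈ r }
    | .inr (_, r), .inr _ => if Dom.bot ∈ r then 1 else 0
  Iright := A.Iright.map Sum.inl
  Ileft := A.Ileft.map Sum.inl
  Oright := A.Oright.map Sum.inl
  Oleft := A.Oleft.map Sum.inl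

/-! ## Sum and sequential composition -/

/-- The sum `A ⊕ B` of open parity games. -/
def sumOPG (A : PreOPG V) (B : PreOPG W) : PreOPG (V ⊕ W) where
  eve := Sum.elim A.eve B.eve
  E := fun x y => match x, y with
    | .inl v, .inl v' => A.E v v'
    | .inr w, .inr w' => B.E w w'
    | _, _ => False
  Ω := fun x y => match x, y with
    | .inl v, .inl v' => A.Ω v v'
    | .inr w, .inr w' => B.Ω w w'
    | _, _ => 0
  Iright := A.Iright.map Sum.inl ++ B.Iright.map Sum.inr
  Ileft := A.Ileft.map Sum.inl ++ B.Ileft.map Sum.inr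
  Oright := A.Oright.map Sum.inl ++ B.Oright.map Sum.inr
  Oleft := A.Oleft.map Sum.inl ++ B.Oleft.map Sum.inr

/-- The (bidirectional) sequential composition `A ⨟ B` of open parity games:
the `k`-th rightward exit of `A` is connected (with priority `0`) to the `k`-th
rightward entrance of `B`, and the `k`-th leftward exit of `B` to the `k`-th
leftward entrance of `A`. -/
def seqOPG (A : PreOPG V) (B : PreOPG W) : PreOPG (V ⊕ W) where
  eve := Sum.elim A.eve B.eve
  E := fun x y => match x, y with
    | .inl v, .inl v' => A.E v v' ∧ v ∉ A.Oright
    | .inr w, .inr w' => B.E w w' ∧ w ∉ B.Oleft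
    | .inl v, .inr w => ∃ k : ℕ, A.Oright[k]? = some v ∧ B.Iright[k]? = some w
    | .inr w, .inl v => ∃ k : ℕ, B.Oleft[k]? = some w ∧ A.Ileft[k]? = some v
  Ω := fun x y => match x, y with
    | .inl v, .inl v' => A.Ω v v'
    | .inr w, .inr w' => B.Ω w w'
    | _, _ => 0
  Iright := A.Iright.map Sum.inl
  Ileft := B.Ileft.map Sum.inr
  Oright := B.Oright.map Sum.inr
  Oleft := A.Oleft.map Sum.inl

/-- The sequential composition `A ⨟ B` is defined when the arities match. -/
def seqDefined (A : PreOPG V) (B : PreOPG W) : Prop :=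
  A.Oright.length = B.Iright.length ∧ B.Oleft.length = A.Ileft.length

/-! ## Entrance-dependent strategies on a sequential composition -/

/-- `i` is the last element of the list `p` that belongs to `I`. -/
def lastOcc {N : Type} (I : List N) (p : List N) (i : N) : Prop :=
  i ∈ I ∧ ∃ s t, p = s ++ i :: t ∧ ∀ x ∈ t, x ∉ I

/-- A positional ∃-strategy, given directly as a function on nodes. -/
def IsPosE (G : PreGame V) (s : V → V) : Prop := ∀ v, G.eve v = true → G.E v (s v)

/-- A positional ∀-strategy, given directly as a function on nodes. -/
def IsPosA (G : PreGame V) (s : V → V) : Prop := ∀ v, G.eve v = false → G.E v (s v)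

/-- Viewing a positional strategy as a history-dependent strategy. -/
def liftPos (s : V → V) : List V → V → V := fun _ v => s v

/-- All the entrances of the two components of a sequential composition. -/
def seqEnts (A : PreOPG V) (B : PreOPG W) : List (V ⊕ W) :=
  A.ent.map Sum.inl ++ B.ent.map Sum.inr

/-- `σ` is an entrance-dependent ∃-strategy on `A ⨟ B` with component families
`σA` (over entrances of `A`) and `σB` (over entrances of `B`). -/
def EntDepE (A : PreOPG V) (B : PreOPG W)
    (σ : List (V ⊕ W) → (V ⊕ W) → (V ⊕ W))
    (σA : V → V → V) (σB : W → W → W) : Prop :=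
  IsEStrat (seqOPG A B).toPreGame σ ∧
  (∀ i' ∈ A.ent, IsPosE A.toPreGame (σA i')) ∧
  (∀ i' ∈ B.ent, IsPosE B.toPreGame (σB i')) ∧
  (∀ h v, (seqOPG A B).eve v = true →
    (∀ i' x, lastOcc (seqEnts A B) (h ++ [v]) (Sum.inl i') → v = Sum.inl x →
        σ h v = Sum.inl (σA i' x)) ∧
    (∀ i' x, lastOcc (seqEnts A B) (h ++ [v]) (Sum.inr i') → v = Sum.inr x →
        σ h v = Sum.inr (σB i' x)))

/-- `σ` is an entrance-dependent ∀-strategy on `A ⨟ B` with component families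
`σA` and `σB`. -/
def EntDepA (A : PreOPG V) (B : PreOPG W)
    (σ : List (V ⊕ W) → (V ⊕ W) → (V ⊕ W))
    (σA : V → V → V) (σB : W → W → W) : Prop :=
  IsAStrat (seqOPG A B).toPreGame σ ∧
  (∀ i' ∈ A.ent, IsPosA A.toPreGame (σA i')) ∧
  (∀ i' ∈ B.ent, IsPosA B.toPreGame (σB i')) ∧
  (∀ h v, (seqOPG A B).eve v = false →
    (∀ i' x, lastOcc (seqEnts A B) (h ++ [v]) (Sum.inl i') → v = Sum.inl x →
        σ h v = Sum.inl (σA i' x)) ∧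
    (∀ i' x, lastOcc (seqEnts A B) (h ++ [v]) (Sum.inr i') → v = Sum.inr x →
        σ h v = Sum.inr (σB i' x)))

/-- `σ` is an entrance-dependent ∀-strategy (for some component families). -/
def IsEntDepA (A : PreOPG V) (B : PreOPG W)
    (σ : List (V ⊕ W) → (V ⊕ W) → (V ⊕ W)) : Prop :=
  ∃ σA σB, EntDepA A B σ σA σB

theorem subPrio_total (m n : ℕ) : SubPrio m n ∨ SubPrio n m := by
  unfold SubPrio
  grind

/-- A numerical rank on the domain, strictly monotone on elements with priorities at most `M`. -/
def domRank (M : ℕ) : Dom V → ℕ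
  | .bot => 0
  | .ex _ m => if m % 2 = 1 then M + 1 - m else M + 2 + m
  | .top => 2 * M + 3

theorem eq_of_domLE_of_domRank_le {M : ℕ} {d d' : Dom V}
    (hd : ∀ o m, d = Dom.ex o m → m ≤ M) (hd' : ∀ o m, d' = Dom.ex o m → m ≤ M)
    (hle : DomLE d' d) (hr : domRank M d ≤ domRank M d') : d' = d := by
  rcases hle with rfl | rfl | ⟨o, m, n, rfl, rfl, h⟩
  · cases d with
    | bot => rfl
    | top => simp [domRank] at hr
    | ex o m =>
      have := hd o m rfl
      simp only [domRank] at hr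
      split_ifs at hr <;> omega
  · cases d' with
    | bot => simp [domRank] at hr
    | top => rfl
    | ex o m =>
      have := hd' o m rfl
      simp only [domRank] at hr
      split_ifs at hr <;> omega
  · have hm := hd' o m rfl
    have hn := hd o n rfl
    suffices m = n by rw [this]
    simp only [SubPrio, Nat.odd_iff, Nat.even_iff] at h
    simp only [domRank] at hr
    split_ifs at hr <;> omega

theorem minSet_nonempty {M : ℕ} {S : Set (Dom V)} (hS : S.Nonempty)
    (hM : ∀ o m, Dom.ex o m ∈ S → m ≤ M) : (minSet S).Nonempty := by
  obtain ⟨d, hd, hmin⟩ := exists_minimalFor_of_wellFoundedLT (· ∈ S) (domRank M) hS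
  refine ⟨d, hd, fun d' hd' hle => eq_of_domLE_of_domRank_le (M := M) ?_ ?_ hle ?_⟩
  · rintro o m rfl
    exact hM o m hd
  · rintro o m rfl
    exact hM o m hd'
  · rcases le_total (domRank M d) (domRank M d') with h | h
    · exact h
    · exact hmin hd' h

theorem domLE_bot_iff {d : Dom V} : DomLE d Dom.bot ↔ d = Dom.bot := by
  simp [DomLE]

theorem bot_mem_minSet_iff {S : Set (Dom V)} : Dom.bot ∈ minSet S ↔ Dom.bot ∈ S :=
  ⟨fun h => h.1, fun h => ⟨h, fun _ _ hle => domLE_bot_iff.1 hle⟩⟩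

theorem top_mem_minSet_iff {S : Set (Dom V)} : Dom.top ∈ minSet S ↔ S = {Dom.top} := by
  constructor
  · rintro ⟨h, hmin⟩
    exact Set.eq_singleton_iff_unique_mem.2 ⟨h, fun d hd => hmin d hd (Or.inr (Or.inl rfl))⟩
  · rintro rfl
    exact ⟨rfl, fun _ hd _ => hd⟩

theorem upLE_of_bot_mem {T T' : Set (Dom V)} (h : Dom.bot ∈ T) : UpLE T T' :=
  fun _ _ => ⟨Dom.bot, h, Or.inl rfl⟩

theorem exists_playDen (A : PreOPG V) (p : ℕ → V) : ∃ d, PlayDen A p d := by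
  by_cases h : ∃ j, p j ∈ A.exits
  · exact ⟨_, Or.inl ⟨Nat.find h, Nat.find_spec h, fun k hk => Nat.find_min h hk, rfl⟩⟩
  · push Not at h
    by_cases hw : PlayWins A.toPreGame p
    · exact ⟨_, Or.inr (Or.inl ⟨h, hw, rfl⟩)⟩
    · exact ⟨_, Or.inr (Or.inr ⟨h, hw, rfl⟩)⟩

theorem exists_isEStrat {G : PreGame V} (hG : ∀ v, ∃ v', G.E v v') : ∃ σ, IsEStrat G σ := by
  choose s hs using hG
  exact ⟨fun _ v => s v, fun _ v _ => hs v⟩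

theorem exists_isAStrat {G : PreGame V} (hG : ∀ v, ∃ v', G.E v v') : ∃ σ, IsAStrat G σ := by
  choose s hs using hG
  exact ⟨fun _ v => s v, fun _ v _ => hs v⟩

theorem playSeq_edge {G : PreGame V} {σe σa : List V → V → V} (he : IsEStrat G σe)
    (ha : IsAStrat G σa) (v : V) (n : ℕ) :
    G.E (playSeq G σe σa v n) (playSeq G σe σa v (n + 1)) := by
  simp only [playSeq, playPath]
  split_ifs with h
  · exact he _ _ h
  · exact ha _ _ (by simpa using h)

theorem denSet_nonempty {A : PreOPG V} (hA : ∀ v, ∃ v', A.E v v') (σe : List V → V → V)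
    (i : V) : (denSet A σe i).Nonempty := by
  obtain ⟨σa, ha⟩ := exists_isAStrat hA
  obtain ⟨d, hd⟩ := exists_playDen A (playSeq A.toPreGame σe σa i)
  exact ⟨d, σa, ha, hd⟩

theorem prio_le_of_ex_mem_denSet {M : ℕ} {A : PreOPG V} (wf : OPGwf M A)
    {σe : List V → V → V} (he : IsEStrat A.toPreGame σe) {i o : V} {m : ℕ}
    (h : Dom.ex o m ∈ denSet A σe i) : m ≤ M := by
  obtain ⟨σa, ha, ⟨j, _, _, hj⟩ | ⟨_, _, hj⟩ | ⟨_, _, hj⟩⟩ := h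
  · obtain ⟨rfl, rfl⟩ := Dom.ex.inj hj
    exact Finset.sup_le fun k _ => wf.prio_le _ _ (playSeq_edge he ha i k)
  · cases hj
  · cases hj

theorem minSet_denSet_nonempty {M : ℕ} {A : PreOPG V} (wf : OPGwf M A)
    {σe : List V → V → V} (he : IsEStrat A.toPreGame σe) (i : V) :
    (minSet (denSet A σe i)).Nonempty :=
  minSet_nonempty (denSet_nonempty wf.succ σe i) fun _ _ h => prio_le_of_ex_mem_denSet wf he h

theorem eq_of_ex_mem_minSet {S : Set (Dom V)} {o : V} {m n : ℕ}
    (hm : Dom.ex o m ∈ minSet S) (hn : Dom.ex o n ∈ minSet S) : m = n := by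
  rcases subPrio_total m n with h | h
  · exact (Dom.ex.inj (hn.2 _ hm.1 (Or.inr (Or.inr ⟨o, m, n, rfl, rfl, h⟩)))).2
  · exact (Dom.ex.inj (hm.2 _ hn.1 (Or.inr (Or.inr ⟨o, n, m, rfl, rfl, h⟩)))).2.symm

theorem winningEnt_iff_exists_pareto {M : ℕ} {A : PreOPG V} (wf : OPGwf M A) (i : V) :
    WinningEnt A i ↔ ∃ T ∈ pareto A i, Dom.top ∈ T := by
  constructor
  · rintro ⟨σe, he, h⟩
    have htop : Dom.top ∈ minSet (denSet A σe i) := top_mem_minSet_iff.2 h.symm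
    refine ⟨_, ⟨⟨σe, he, rfl⟩, ?_⟩, htop⟩
    rintro _ ⟨σ', he', rfl⟩ - d hd
    obtain ⟨d', hd'⟩ := minSet_denSet_nonempty wf he' i
    rw [← h] at hd
    exact ⟨d', hd', Or.inr (Or.inl hd.1)⟩
  · rintro ⟨_, ⟨⟨σe, he, rfl⟩, _⟩, htop⟩
    exact ⟨σe, he, (top_mem_minSet_iff.1 htop).symm⟩

theorem losingEnt_iff_exists_pareto {M : ℕ} {A : PreOPG V} (wf : OPGwf M A) (i : V) :
    LosingEnt A i ↔ ∃ T ∈ pareto A i, Dom.bot ∈ T := by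
  constructor
  · intro h
    obtain ⟨σe, he⟩ := exists_isEStrat wf.succ
    refine ⟨_, ⟨⟨σe, he, rfl⟩, ?_⟩, bot_mem_minSet_iff.2 (h _ ⟨σe, he, rfl⟩)⟩
    rintro _ ⟨σ', he', rfl⟩ -
    exact upLE_of_bot_mem (bot_mem_minSet_iff.2 (h _ ⟨σ', he', rfl⟩))
  · rintro ⟨T, ⟨_, hmax⟩, hbot⟩ _ ⟨σ', he', rfl⟩
    obtain ⟨d, hd, hle⟩ := hmax _ ⟨σ', he', rfl⟩ (upLE_of_bot_mem hbot) _ hbot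
    rw [domLE_bot_iff.1 hle] at hd
    exact hd.1

/-- the entrance `i` is pending iff every `T ∈ Pr(A, i)` contains
neither `⊤` nor `⊥`, and exits appear in `T` with a unique priority. -/
theorem pending_iff_pareto {V : Type} (M : ℕ) (hM : Even M) (hM2 : 2 ≤ M)
    (A : PreOPG V) (wf : OPGwf M A) (i : V) (hi : i ∈ A.ent) :
    PendingEnt A i ↔
      ∀ T ∈ pareto A i, Dom.top ∉ T ∧ Dom.bot ∉ T ∧
        ∀ o1 m1 o2 m2, Dom.ex o1 m1 ∈ T → Dom.ex o2 m2 ∈ T → o1 = o2 → m1 = m2 := by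
  rw [PendingEnt, winningEnt_iff_exists_pareto wf, losingEnt_iff_exists_pareto wf]
  constructor
  · rintro ⟨hw, hl⟩ T hT
    refine ⟨fun h => hw ⟨T, hT, h⟩, fun h => hl ⟨T, hT, h⟩, ?_⟩
    obtain ⟨⟨σe, _, rfl⟩, _⟩ := hT
    rintro o m _ n hm hn rfl
    exact eq_of_ex_mem_minSet hm hn
  · intro h
    exact ⟨fun ⟨T, hT, htop⟩ => (h T hT).1 htop, fun ⟨T, hT, hbot⟩ => (h T hT).2.1 hbot⟩
end

section
/- (Positional determinacy of Pareto fronts.) For any oPG A and any entrance i of A, the Pareto front is positionally determined: Pr(A, i) = Max{ Min{ ⟦play(σ∃, σ∀, i)⟧ : σ∀ a positional ∀-strategy } : σ∃ a positional ∃-strategy }. -/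
open scoped Classical

variable {V W : Type}

/-! ## Positional determinacy of finite parity games -/

/-- The largest priority occurring infinitely often along `p` exists and satisfies `g`. -/
def LimPrio (Ω : V → V → ℕ) (g : ℕ → Prop) (p : ℕ → V) : Prop :=
  ∃ m, g m ∧ (∃ᶠ j in Filter.atTop, Ω (p j) (p (j + 1)) = m) ∧
    ∀ m', (∃ᶠ j in Filter.atTop, Ω (p j) (p (j + 1)) = m') → m' ≤ m

/-- The positional strategy `s` of the player owning the nodes in `own` wins from every node of
`W`, in the game that stops at the first edge in `Sp` (won iff that edge is in `B`), and that is
decided by the largest recurring priority satisfying `g` if no edge in `Sp` is taken. -/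
structure WinsBy (own : V → Prop) (E : V → V → Prop) (Ω : V → V → ℕ) (g : ℕ → Prop)
    (Sp B : V → V → Prop) (W : Set V) (s : V → V) : Prop where
  legal : ∀ v, E v (s v)
  final : ∀ v ∈ W, ∀ w, E v w → (own v → w = s v) → Sp v w → B v w
  closed : ∀ v ∈ W, ∀ w, E v w → (own v → w = s v) → ¬ Sp v w → w ∈ W
  limit : ∀ p : ℕ → V, (∀ n, p n ∈ W) → (∀ n, E (p n) (p (n + 1))) →
    (∀ n, own (p n) → p (n + 1) = s (p n)) → (∀ n, ¬ Sp (p n) (p (n + 1))) → LimPrio Ω g p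

theorem LimPrio.of_tail {Ω : V → V → ℕ} {g : ℕ → Prop} {p : ℕ → V} (N : ℕ)
    (h : LimPrio Ω g fun n => p (n + N)) : LimPrio Ω g p := by
  have key : ∀ m, (∃ᶠ j in Filter.atTop, Ω (p (j + N)) (p (j + 1 + N)) = m) ↔
      ∃ᶠ j in Filter.atTop, Ω (p j) (p (j + 1)) = m := by
    intro m
    conv_rhs => rw [← Filter.map_add_atTop_eq_nat N, Filter.frequently_map]
    simp only [Nat.add_right_comm _ 1 N]
  obtain ⟨m, hg, hm, hmax⟩ := h
  exact ⟨m, hg, (key m).1 hm, fun m' h' => hmax m' ((key m').2 h')⟩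

theorem LimPrio.not_of_not {Ω : V → V → ℕ} {g : ℕ → Prop} {p : ℕ → V}
    (h : LimPrio Ω (fun m => ¬ g m) p) : ¬ LimPrio Ω g p := by
  rintro ⟨m, hg, hm, hmax⟩
  obtain ⟨m', hg', hm', hmax'⟩ := h
  exact hg' (le_antisymm (hmax' m hm) (hmax m' hm') ▸ hg)

/-- One of the two players wins positionally from each node. -/
def PosDet (own : V → Prop) (E : V → V → Prop) (Ω : V → V → ℕ) (g : ℕ → Prop)
    (Sp B : V → V → Prop) : Prop :=
  ∃ W W' s s', WinsBy own E Ω g Sp B W s ∧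
    WinsBy (fun v => ¬ own v) E Ω (fun m => ¬ g m) Sp (fun v w => ¬ B v w) W' s' ∧
    ∀ v, v ∈ W ∨ v ∈ W'

theorem PosDet.swap {own : V → Prop} {E : V → V → Prop} {Ω : V → V → ℕ} {g : ℕ → Prop}
    {Sp B : V → V → Prop}
    (h : PosDet (fun v => ¬ own v) E Ω (fun m => ¬ g m) Sp (fun v w => ¬ B v w)) :
    PosDet own E Ω g Sp B := by
  obtain ⟨W, W', s, s', h1, h2, h3⟩ := h
  simp only [not_not] at h2
  exact ⟨W', W, s', s, h2, h1, fun v => (h3 v).symm⟩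

theorem posDet_of_all_final {E : V → V → Prop} (tot : ∀ v, ∃ w, E v w) (own : V → Prop)
    (Ω : V → V → ℕ) (g : ℕ → Prop) (Sp B : V → V → Prop) (hSp : ∀ v w, E v w → Sp v w) :
    PosDet own E Ω g Sp B := by
  have ch : ∀ C : V → V → Prop, ∃ s : V → V,
      ∀ v, E v (s v) ∧ ((∃ w, E v w ∧ C v w) → C v (s v)) := by
    intro C
    suffices h : ∀ v, ∃ w, E v w ∧ ((∃ w, E v w ∧ C v w) → C v w) from Classical.skolem.1 h
    intro v
    by_cases h : ∃ w, E v w ∧ C v w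
    · obtain ⟨w, hw, hC⟩ := h
      exact ⟨w, hw, fun _ => hC⟩
    · obtain ⟨w, hw⟩ := tot v
      exact ⟨w, hw, fun h' => absurd h' h⟩
  obtain ⟨s, hs⟩ := ch B
  obtain ⟨s', hs'⟩ := ch fun v w => ¬ B v w
  refine ⟨{v | (own v ∧ ∃ w, E v w ∧ B v w) ∨ ¬ own v ∧ ∀ w, E v w → B v w},
    {v | (¬ own v ∧ ∃ w, E v w ∧ ¬ B v w) ∨ own v ∧ ∀ w, E v w → ¬ B v w}, s, s',
    ⟨fun v => (hs v).1, ?_, fun v _ w hw _ h => absurd (hSp v w hw) h,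
      fun p _ hE _ h => absurd (hSp _ _ (hE 0)) (h 0)⟩,
    ⟨fun v => (hs' v).1, ?_, fun v _ w hw _ h => absurd (hSp v w hw) h,
      fun p _ hE _ h => absurd (hSp _ _ (hE 0)) (h 0)⟩, ?_⟩
  · rintro v (⟨ho, hex⟩ | ⟨ho, hall⟩) w hw hcons -
    · exact hcons ho ▸ (hs v).2 hex
    · exact hall w hw
  · rintro v (⟨ho, hex⟩ | ⟨ho, hall⟩) w hw hcons -
    · exact hcons ho ▸ (hs' v).2 hex
    · exact hall w hw
  · intro v
    simp only [Set.mem_ofPred_eq]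
    by_cases ho : own v <;> simp only [ho, true_and, false_and, not_true, not_false_eq_true,
      or_false, false_or]
    · by_cases h : ∃ w, E v w ∧ B v w
      · exact Or.inl h
      · exact Or.inr fun w hw hB => h ⟨w, hw, hB⟩
    · by_cases h : ∃ w, E v w ∧ ¬ B v w
      · exact Or.inr h
      · exact Or.inl fun w hw => by_contra fun hB => h ⟨w, hw, hB⟩

/-- Determinacy with one more priority `d`, favourable to the player `own`: stop the game at edges
of priority `d` as well, the opponent winning there iff the target lies in a maximal winning
set `Y` of the opponent. -/
theorem posDet_succ [Finite V] {E : V → V → Prop} (tot : ∀ v, ∃ w, E v w) {own : V → Prop}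
    {Ω : V → V → ℕ} {g : ℕ → Prop} {Sp B : V → V → Prop} {d : ℕ} (hd : g d)
    (hΩ : ∀ v w, E v w → ¬ Sp v w → Ω v w ≤ d)
    (ih : ∀ B', PosDet own E Ω g (fun v w => Sp v w ∨ Ω v w = d) B') :
    PosDet own E Ω g Sp B := by
  obtain ⟨s₀, hs₀⟩ := Classical.skolem.1 tot
  obtain ⟨Y, hY⟩ := (Set.toFinite {Y : Set V | ∃ s, WinsBy (fun v => ¬ own v) E Ω
    (fun m => ¬ g m) Sp (fun v w => ¬ B v w) Y s}).exists_maximal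
    ⟨∅, s₀, hs₀, by simp, by simp, fun p hp => absurd (hp 0) (by simp)⟩
  obtain ⟨⟨sY, wY⟩, hmax⟩ := hY
  obtain ⟨W, W', s, s', w1, w2, cov⟩ :=
    ih fun v w => (Sp v w ∧ B v w) ∨ (¬ Sp v w ∧ w ∉ Y)
  have step : ∀ v ∈ W', ∀ w, E v w → (¬ own v → w = s' v) → ¬ Sp v w → Ω v w = d → w ∈ Y := by
    intro v hv w hw hc hsp hd
    have := w2.final v hv w hw hc (Or.inr hd)
    by_contra hy
    exact this (Or.inr ⟨hsp, hy⟩)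
  have hW' : W' ⊆ Y := by
    refine Set.subset_union_right.trans (hmax (y := Y ∪ W')
      ⟨fun v => if v ∈ Y then sY v else s' v, ?_, ?_, ?_, ?_⟩ Set.subset_union_left)
    · intro v
      split_ifs
      · exact wY.legal v
      · exact w2.legal v
    · intro v hv w hw hc hsp
      by_cases hvY : v ∈ Y
      · exact wY.final v hvY w hw (by simpa [hvY] using hc) hsp
      · have := w2.final v (hv.resolve_left hvY) w hw (by simpa [hvY] using hc) (Or.inl hsp)
        exact fun hB => this (Or.inl ⟨hsp, hB⟩)
    · intro v hv w hw hc hsp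
      by_cases hvY : v ∈ Y
      · exact Or.inl (wY.closed v hvY w hw (by simpa [hvY] using hc) hsp)
      · have hv' := hv.resolve_left hvY
        have hc' : ¬ own v → w = s' v := by simpa [hvY] using hc
        by_cases hd' : Ω v w = d
        · exact Or.inl (step v hv' w hw hc' hsp hd')
        · exact Or.inr (w2.closed v hv' w hw hc' (by tauto))
    · intro p hp hE hc hsp
      by_cases hex : ∃ N, p N ∈ Y
      · obtain ⟨N, hN⟩ := hex
        have hin : ∀ n, p (n + N) ∈ Y := by
          intro n
          induction n with
          | zero => simpa using hN
          | succ n ihn =>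
            have := wY.closed _ ihn _ (hE (n + N))
              (fun ho => by simpa [ihn] using hc (n + N) ho) (hsp _)
            rwa [Nat.add_right_comm] at this
        refine LimPrio.of_tail N (wY.limit _ hin ?_ ?_ ?_)
        · intro n
          simpa only [Nat.add_right_comm] using hE (n + N)
        · intro n ho
          have := hc (n + N) ho
          simp only [hin n, if_true] at this
          simpa only [Nat.add_right_comm] using this
        · intro n
          simpa only [Nat.add_right_comm] using hsp (n + N)
      · have hout : ∀ n, p n ∉ Y := fun n h => hex ⟨n, h⟩
        have hc' : ∀ n, ¬ own (p n) → p (n + 1) = s' (p n) := fun n ho => by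
          simpa [hout n] using hc n ho
        have hin : ∀ n, p n ∈ W' := fun n => (hp n).resolve_left (hout n)
        refine w2.limit p hin hE hc' fun n h => ?_
        rcases h with h | h
        · exact hsp n h
        · exact hout _ (step _ (hin n) _ (hE n) (hc' n) (hsp n) h)
  refine ⟨W, Y, s, sY, ⟨w1.legal, ?_, ?_, ?_⟩, wY, fun v => (cov v).imp_right (@hW' v)⟩
  · intro v hv w hw hc hsp
    have := w1.final v hv w hw hc (Or.inl hsp)
    tauto
  · intro v hv w hw hc hsp
    by_cases hd' : Ω v w = d
    · rcases w1.final v hv w hw hc (Or.inr hd') with h | h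
      · exact absurd h.1 hsp
      · exact (cov w).resolve_right fun h' => h.2 (hW' h')
    · exact w1.closed v hv w hw hc (by tauto)
  · intro p hp hE hc hsp
    by_cases hf : ∃ᶠ j in Filter.atTop, Ω (p j) (p (j + 1)) = d
    · refine ⟨d, hd, hf, fun m' h' => ?_⟩
      obtain ⟨j, hj⟩ := h'.exists
      exact hj ▸ hΩ _ _ (hE j) (hsp j)
    · rw [Filter.not_frequently, Filter.eventually_atTop] at hf
      obtain ⟨N, hN⟩ := hf
      refine LimPrio.of_tail N (w1.limit _ (fun n => hp _) ?_ ?_ ?_)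
      · intro n
        simpa only [Nat.add_right_comm] using hE (n + N)
      · intro n ho
        simpa only [Nat.add_right_comm] using hc (n + N) ho
      · intro n h
        rw [Nat.add_right_comm] at h
        exact h.elim (hsp _) (hN _ (Nat.le_add_left _ _))

theorem posDet_of_lt [Finite V] {E : V → V → Prop} (tot : ∀ v, ∃ w, E v w) (Ω : V → V → ℕ)
    (d : ℕ) : ∀ (own : V → Prop) (g : ℕ → Prop) (Sp B : V → V → Prop),
      (∀ v w, E v w → ¬ Sp v w → Ω v w < d) → PosDet own E Ω g Sp B := by
  induction d with
  | zero =>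
    intro own g Sp B h
    exact posDet_of_all_final tot own Ω g Sp B fun v w hw =>
      by_contra fun hn => Nat.not_lt_zero _ (h v w hw hn)
  | succ d ih =>
    intro own g Sp B h
    have hle : ∀ v w, E v w → ¬ Sp v w → Ω v w ≤ d := fun v w hw hn =>
      Nat.lt_succ_iff.1 (h v w hw hn)
    have hlt : ∀ v w, E v w → ¬ (Sp v w ∨ Ω v w = d) → Ω v w < d := fun v w hw hn =>
      lt_of_le_of_ne (hle v w hw fun hs => hn (Or.inl hs)) fun he => hn (Or.inr he)
    by_cases hd : g d
    · exact posDet_succ tot hd hle fun B' => ih _ _ _ _ hlt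
    · exact PosDet.swap (posDet_succ tot hd hle fun B' => ih _ _ _ _ hlt)

/-! ## Looping the exits back to the entrance -/

/-- Positional determinacy of the game in which each exit `o` leads back to `i` with priority
`q o`, read off on the plays of the open game: a play that avoids the exits is decided by the
parity condition, and one that reaches `o` with largest priority `m` by the parity of
`max m (q o)`. -/
def LoopWins (own : V → Prop) (E : V → V → Prop) (Ω : V → V → ℕ) (g : ℕ → Prop) (ex : V → Prop)
    (i : V) (q : V → ℕ) (s : V → V) : Prop :=
  (∀ v, ¬ ex v → E v (s v)) ∧
  ∀ p : ℕ → V, p 0 = i → (∀ n, ¬ ex (p n) → E (p n) (p (n + 1))) →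
    (∀ n, ¬ ex (p n) → own (p n) → p (n + 1) = s (p n)) →
    ((∀ n, ¬ ex (p n)) → LimPrio Ω g p) ∧
    ∀ j, ex (p j) → (∀ k, k < j → ¬ ex (p k)) →
      g (max ((Finset.range j).sup fun k => Ω (p k) (p (k + 1))) (q (p j)))

theorem LimPrio.of_periodic {Ω : V → V → ℕ} {g : ℕ → Prop} {p : ℕ → V} {N : ℕ} (hN : 0 < N)
    (hp : ∀ n, p (n % N) = p n) (h : LimPrio Ω g p) :
    g ((Finset.range N).sup fun k => Ω (p k) (p (k + 1))) := by
  obtain ⟨m, hg, hm, hmax⟩ := h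
  have hstep : ∀ n, Ω (p (n % N)) (p (n % N + 1)) = Ω (p n) (p (n + 1)) := fun n => by
    rw [hp n, ← hp (n % N + 1), Nat.mod_add_mod, hp]
  convert hg
  refine le_antisymm (Finset.sup_le fun k hk => hmax _ ?_) ?_
  · rw [Filter.frequently_atTop]
    intro a
    refine ⟨k + N * a, (Nat.le_mul_of_pos_left a hN).trans (Nat.le_add_left _ _), ?_⟩
    rw [← hstep, Nat.add_mul_mod_self_left, Nat.mod_eq_of_lt (Finset.mem_range.1 hk)]
  · obtain ⟨j, hj⟩ := hm.exists
    rw [← hj, ← hstep]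
    exact Finset.le_sup (f := fun k => Ω (p k) (p (k + 1)))
      (Finset.mem_range.2 (Nat.mod_lt _ hN))

theorem WinsBy.loopWins {own : V → Prop} {E : V → V → Prop} {Ω : V → V → ℕ} {g : ℕ → Prop}
    {ex : V → Prop} {i : V} {q : V → ℕ} {B : V → V → Prop} {W : Set V} {s : V → V} (hi : i ∈ W)
    (h : WinsBy own (fun v w => (ex v ∧ w = i) ∨ (¬ ex v ∧ E v w))
      (fun v w => if ex v then q v else Ω v w) g (fun _ _ => False) B W s) :
    LoopWins own E Ω g ex i q s := by
  have hall : ∀ p : ℕ → V, p 0 = i →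
      (∀ n, (ex (p n) ∧ p (n + 1) = i) ∨ (¬ ex (p n) ∧ E (p n) (p (n + 1)))) →
      (∀ n, ¬ ex (p n) → own (p n) → p (n + 1) = s (p n)) →
      LimPrio (fun v w => if ex v then q v else Ω v w) g p := by
    intro p h0 hE hc
    have hc' : ∀ n, own (p n) → p (n + 1) = s (p n) := by
      intro n ho
      rcases hE n with ⟨hx, hn⟩ | ⟨hx, -⟩
      · rcases h.legal (p n) with ⟨-, hl⟩ | ⟨hl, -⟩
        · rw [hn, hl]
        · exact absurd hx hl
      · exact hc n hx ho
    refine h.limit p (fun n => ?_) hE hc' fun _ => id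
    induction n with
    | zero => rwa [h0]
    | succ n ihn => exact h.closed _ ihn _ (hE n) (hc' n) id
  refine ⟨fun v hv => ((h.legal v).resolve_left fun h' => hv h'.1).2, fun p h0 hE hc => ⟨?_, ?_⟩⟩
  · intro hx
    have := hall p h0 (fun n => Or.inr ⟨hx n, hE n (hx n)⟩) hc
    simpa only [LimPrio, hx, if_false] using this
  · intro j hj hlt
    have hlast : ∀ n, n % (j + 1) < j ∨ n % (j + 1) = j := fun n =>
      Nat.lt_or_eq_of_le (Nat.lt_succ_iff.1 (Nat.mod_lt n j.succ_pos))
    have hs1 : ∀ n, n % (j + 1) < j → (n + 1) % (j + 1) = n % (j + 1) + 1 := fun n hn => by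
      rw [← Nat.mod_add_mod, Nat.mod_eq_of_lt (by omega)]
    have hs2 : ∀ n, n % (j + 1) = j → (n + 1) % (j + 1) = 0 := fun n hn => by
      rw [← Nat.mod_add_mod, hn, Nat.mod_self]
    have := LimPrio.of_periodic (N := j + 1) j.succ_pos (fun n => by simp only [Nat.mod_mod])
      (hall (fun n => p (n % (j + 1))) (by simpa using h0) ?_ ?_)
    · rw [Finset.range_add_one, Finset.sup_insert, max_comm] at this
      rw [Finset.sup_congr rfl (g := fun k => Ω (p k) (p (k + 1))), Nat.mod_eq_of_lt (by omega),
        if_pos hj] at this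
      · exact this
      · intro k hk
        have hk' := Finset.mem_range.1 hk
        rw [Nat.mod_eq_of_lt (by omega : k < j + 1), Nat.mod_eq_of_lt (by omega : k + 1 < j + 1),
          if_neg (hlt k hk')]
    · intro n
      rcases hlast n with hn | hn
      · right
        simp only [hs1 n hn]
        exact ⟨hlt _ hn, hE _ (hlt _ hn)⟩
      · left
        simp only [hs2 n hn]
        rw [hn]
        exact ⟨hj, h0⟩
    · intro n hx ho
      rcases hlast n with hn | hn
      · simp only [hs1 n hn]
        exact hc _ hx ho
      · simp only [hn] at hx
        exact absurd hj hx

theorem loopWins_or [Finite V] {E : V → V → Prop} (tot : ∀ v, ∃ w, E v w) (own : V → Prop)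
    (Ω : V → V → ℕ) (g : ℕ → Prop) (ex : V → Prop) (i : V) (q : V → ℕ) :
    (∃ s, LoopWins own E Ω g ex i q s) ∨
      ∃ s, LoopWins (fun v => ¬ own v) E Ω (fun m => ¬ g m) ex i q s := by
  obtain ⟨N, hN⟩ := (Set.finite_range fun x : V × V => if ex x.1 then q x.1 else Ω x.1 x.2).bddAbove
  obtain ⟨W, W', s, s', h1, h2, cov⟩ :=
    posDet_of_lt (E := fun v w => (ex v ∧ w = i) ∨ (¬ ex v ∧ E v w))
      (fun v => by
        by_cases h : ex v
        · exact ⟨i, Or.inl ⟨h, rfl⟩⟩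
        · exact (tot v).imp fun w hw => Or.inr ⟨h, hw⟩)
      (fun v w => if ex v then q v else Ω v w) (N + 1) own g (fun _ _ => False) (fun _ _ => True)
      (fun v w _ _ => Nat.lt_succ_of_le (hN ⟨(v, w), rfl⟩))
  rcases cov i with hi | hi
  · exact Or.inl ⟨s, h1.loopWins hi⟩
  · exact Or.inr ⟨s', h2.loopWins hi⟩

/-! ## Plays and denotations -/

theorem playSeq_succ_eve {G : PreGame V} {σe σa : List V → V → V} {v : V} {n : ℕ}
    (h : G.eve (playSeq G σe σa v n) = true) :
    playSeq G σe σa v (n + 1) = σe (playPath G σe σa v n).1 (playSeq G σe σa v n) :=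
  if_pos h

theorem playSeq_succ_adam {G : PreGame V} {σe σa : List V → V → V} {v : V} {n : ℕ}
    (h : ¬ G.eve (playSeq G σe σa v n) = true) :
    playSeq G σe σa v (n + 1) = σa (playPath G σe σa v n).1 (playSeq G σe σa v n) :=
  if_neg h

theorem sup_prio_le {M : ℕ} {A : PreOPG V} (wf : OPGwf M A) {p : ℕ → V}
    (hp : ∀ n, A.E (p n) (p (n + 1))) (j : ℕ) :
    ((Finset.range j).sup fun k => A.Ω (p k) (p (k + 1))) ≤ M :=
  Finset.sup_le fun k _ => wf.prio_le _ _ (hp k)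

/-! ## The domain order -/

instance : PartialOrder (Dom V) where
  le := DomLE
  le_refl d := by
    cases d with
    | bot => exact Or.inl rfl
    | top => exact Or.inr (Or.inl rfl)
    | ex o m => exact Or.inr (Or.inr ⟨o, m, m, rfl, rfl, by unfold SubPrio; grind⟩)
  le_trans a b c hab hbc := by
    rcases hab with rfl | rfl | ⟨o, m1, m2, rfl, rfl, h⟩
    · exact Or.inl rfl
    · rcases hbc with h | rfl | ⟨o, m1, m2, h, -⟩
      · cases h
      · exact Or.inr (Or.inl rfl)
      · cases h
    · rcases hbc with h' | rfl | ⟨o', m1', m2', h1, rfl, h'⟩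
      · cases h'
      · exact Or.inr (Or.inl rfl)
      · cases h1
        exact Or.inr (Or.inr ⟨o, m1, m2', rfl, rfl, by unfold SubPrio at *; grind⟩)
  le_antisymm a b hab hba := by
    rcases hab with rfl | rfl | ⟨o, m1, m2, rfl, rfl, h⟩
    · rcases hba with rfl | h | ⟨o, m1, m2, -, h, -⟩
      · rfl
      · cases h
      · cases h
    · rcases hba with h | rfl | ⟨o, m1, m2, h, -⟩
      · cases h
      · rfl
      · cases h
    · rcases hba with h' | h' | ⟨o', m1', m2', h1, h2, h'⟩
      · cases h'
      · cases h'
      · cases h1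
        cases h2
        congr 1
        unfold SubPrio at *
        grind

theorem domLE_ex_iff {o o' : V} {m m' : ℕ} :
    DomLE (Dom.ex o m) (Dom.ex o' m') ↔ o = o' ∧ SubPrio m m' := by
  constructor
  · rintro (h | h | ⟨_, _, _, h1, h2, h⟩)
    · cases h
    · cases h
    · cases h1
      cases h2
      exact ⟨rfl, h⟩
  · rintro ⟨rfl, h⟩
    exact Or.inr (Or.inr ⟨_, _, _, rfl, rfl, h⟩)

theorem minSet_eq_of_subset {D D' : Set (Dom V)} (hsub : D' ⊆ D) (h : UpLE D' D) :
    minSet D = minSet D' := by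
  have key : ∀ d ∈ minSet D, d ∈ D' := by
    rintro d ⟨hd, hmin⟩
    obtain ⟨d', hd', hle⟩ := h d hd
    exact hmin d' (hsub hd') hle ▸ hd'
  ext d
  constructor
  · exact fun hd => ⟨key d hd, fun d' hd' => hd.2 d' (hsub hd')⟩
  · rintro ⟨hd, hmin⟩
    refine ⟨hsub hd, fun d' hd' hle => ?_⟩
    obtain ⟨d'', hd'', hle'⟩ := h d' hd'
    have := hmin d'' hd'' (le_trans (α := Dom V) hle' hle)
    subst this
    exact le_antisymm (α := Dom V) hle hle'

theorem upLE_minSet_self {D : Set (Dom V)} (hD : D.Finite) : UpLE (minSet D) D := by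
  intro d hd
  obtain ⟨d', hle, hd', hmin⟩ := hD.exists_le_minimal hd
  exact ⟨d', ⟨hd', fun e he hle' => le_antisymm (α := Dom V) hle' (hmin he hle')⟩, hle⟩

theorem UpLE.trans {T₁ T₂ T₃ : Set (Dom V)} (h : UpLE T₁ T₂) (h' : UpLE T₂ T₃) : UpLE T₁ T₃ := by
  intro d hd
  obtain ⟨d', hd', hle⟩ := h' d hd
  obtain ⟨d'', hd'', hle'⟩ := h d' hd'
  exact ⟨d'', hd'', le_trans (α := Dom V) hle' hle⟩

theorem minSet_subset_of_upLE {D D' : Set (Dom V)} (h : UpLE (minSet D) (minSet D'))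
    (h' : UpLE (minSet D') (minSet D)) : minSet D' ⊆ minSet D := by
  intro d hd
  obtain ⟨d₁, hd₁, hle₁⟩ := h d hd
  obtain ⟨d₂, hd₂, hle₂⟩ := h' d₁ hd₁
  have := hd.2 d₂ hd₂.1 (le_trans (α := Dom V) hle₂ hle₁)
  subst this
  rwa [le_antisymm (α := Dom V) hle₂ hle₁]

theorem denSet_finite {M : ℕ} {A : PreOPG V} (wf : OPGwf M A) {σe : List V → V → V}
    (he : IsEStrat A.toPreGame σe) (i : V) : (denSet A σe i).Finite := by
  have := wf.finite
  refine (((Set.finite_univ (α := V)).prod (Set.finite_Iic M)).image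
    (fun x => Dom.ex x.1 x.2) |>.union (Set.toFinite {Dom.top, Dom.bot})).subset ?_
  rintro d ⟨σa, ha, ⟨j, -, -, rfl⟩ | ⟨-, -, rfl⟩ | ⟨-, -, rfl⟩⟩
  · exact Or.inl ⟨(_, _), ⟨trivial, sup_prio_le wf (playSeq_edge he ha i) j⟩, rfl⟩
  · exact Or.inr (Or.inl rfl)
  · exact Or.inr (Or.inr rfl)

/-! ## Loop priorities encoding thresholds -/

theorem exists_loop_prio_up {M : ℕ} (hM : Even M) (S : Set ℕ) (hS : ∀ m ∈ S, m ≤ M) :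
    ∃ q, ∀ m ≤ M, Even (max m q) ↔ ∃ m' ∈ S, SubPrio m' m := by
  have hfin : S.Finite := (Set.finite_Iic M).subset hS
  by_cases h1 : ∃ m ∈ S, Odd m
  · obtain ⟨k, ⟨hk, hko⟩, hmax⟩ :=
      (hfin.subset (Set.sep_subset S Odd)).exists_maximal h1
    refine ⟨k + 1, fun m _ => ⟨fun he => ⟨k, hk, ?_⟩, ?_⟩⟩
    · unfold SubPrio
      grind
    · rintro ⟨m', hm', hle⟩
      have : Odd m' → m' ≤ k := fun ho => (le_total m' k).elim id (hmax ⟨hm', ho⟩)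
      unfold SubPrio at hle
      grind
  · by_cases h2 : S.Nonempty
    · obtain ⟨k, hk, hmin⟩ := hfin.exists_minimal h2
      have hmin' : ∀ m ∈ S, k ≤ m := fun m hm => (le_total k m).elim id (hmin hm)
      have heven : ∀ m ∈ S, Even m := fun m hm => Nat.not_odd_iff_even.1 fun ho => h1 ⟨m, hm, ho⟩
      have hke := heven k hk
      refine ⟨k - 1, fun m _ => ⟨fun he => ⟨k, hk, ?_⟩, ?_⟩⟩
      · unfold SubPrio
        grind
      · rintro ⟨m', hm', hle⟩
        have := hmin' m' hm'
        have := heven m' hm'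
        unfold SubPrio at hle
        grind
    · refine ⟨M + 1, fun m hm => ⟨fun he => ?_, fun ⟨m', hm', _⟩ => absurd ⟨m', hm'⟩ h2⟩⟩
      grind

theorem exists_loop_prio_down {M : ℕ} (hM : Even M) {d : Dom V} (hd : d ≠ Dom.top) (o : V) :
    ∃ q, ∀ m ≤ M, ¬ Even (max m q) ↔ DomLE (Dom.ex o m) d := by
  cases d with
  | top => exact absurd rfl hd
  | bot =>
    refine ⟨M + 2, fun m hm => ⟨fun h => ?_, ?_⟩⟩
    · grind
    · rintro (h | h | ⟨_, _, _, _, h, _⟩) <;> cases h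
  | ex o' k =>
    by_cases ho : o = o'
    · refine ⟨if Odd k then k - 1 else k + 1, fun m _ => ?_⟩
      rw [domLE_ex_iff]
      unfold SubPrio
      split_ifs <;> grind
    · refine ⟨M + 2, fun m hm => ⟨fun h => ?_, fun h => absurd (domLE_ex_iff.1 h).1 ho⟩⟩
      grind

/-! ## Positional strategies suffice -/

/-- `{ ⟦play(σe, σa, i)⟧ : σa a positional ∀-strategy }`. -/
def posDenSet (A : PreOPG V) (σe : List V → V → V) (i : V) : Set (Dom V) :=
  { d | ∃ σa, IsAStrat A.toPreGame σa ∧ Positional σa ∧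
    PlayDen A (playSeq A.toPreGame σe σa i) d }

theorem not_mem_exits_of_adam {M : ℕ} {A : PreOPG V} (wf : OPGwf M A) {v : V}
    (h : A.eve v = false) : v ∉ A.exits := fun hv => by
  have := wf.ends_eve v (List.mem_append_right _ hv)
  simp [this] at h

theorem upLE_posDenSet {M : ℕ} (hM : Even M) {A : PreOPG V} (wf : OPGwf M A) (i : V)
    {σe : List V → V → V} (he : IsEStrat A.toPreGame σe) (hpos : Positional σe) :
    UpLE (posDenSet A σe i) (denSet A σe i) := by
  have := wf.finite
  rintro d ⟨σa, ha, hden⟩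
  have hE1 : ∀ {τ : List V → V → V}, IsAStrat A.toPreGame τ → ∀ n,
      A.E (playSeq A.toPreGame σe τ i n) (playSeq A.toPreGame σe τ i (n + 1)) ∧
        (A.eve (playSeq A.toPreGame σe τ i n) = true →
          playSeq A.toPreGame σe τ i (n + 1) = σe [] (playSeq A.toPreGame σe τ i n)) :=
    fun hτ n => ⟨playSeq_edge he hτ i n, fun h => (playSeq_succ_eve h).trans (hpos _ _ _)⟩
  by_cases hd : d = Dom.top
  · obtain ⟨s, hs⟩ := Classical.skolem.1 wf.succ
    obtain ⟨d', hd'⟩ := exists_playDen A (playSeq A.toPreGame σe (liftPos s) i)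
    exact ⟨d', ⟨liftPos s, fun _ v _ => hs v, fun _ _ _ => rfl, hd'⟩, Or.inr (Or.inl hd)⟩
  choose q hq using exists_loop_prio_down (V := V) hM hd
  rcases loopWins_or (E := fun v w => A.E v w ∧ (A.eve v = true → w = σe [] v))
    (fun v => by
      by_cases hv : A.eve v = true
      · exact ⟨σe [] v, he _ _ hv, fun _ => rfl⟩
      · exact (wf.succ v).imp fun w hw => ⟨hw, fun h => absurd h hv⟩)
    (fun v => A.eve v = true) A.Ω Even (· ∈ A.exits) i q with ⟨s, hs, hw⟩ | ⟨s, hs, hw⟩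
  · exfalso
    obtain ⟨h1, h2⟩ := hw (playSeq A.toPreGame σe σa i) rfl (fun n _ => hE1 ha n)
      (fun n hx ho => ((hE1 ha n).2 ho).trans ((hs _ hx).2 ho).symm)
    rcases hden with ⟨j, hj, hlt, rfl⟩ | ⟨-, -, rfl⟩ | ⟨hno, hl, rfl⟩
    · exact (hq _ _ (sup_prio_le wf (fun n => (hE1 ha n).1) j)).2
        (le_refl (α := Dom V) _) (h2 j hj hlt)
    · exact hd rfl
    · exact hl (h1 hno)
  · have hτ : IsAStrat A.toPreGame (liftPos s) := fun _ v hv =>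
      (hs v (not_mem_exits_of_adam wf hv)).1
    obtain ⟨h1, h2⟩ := hw (playSeq A.toPreGame σe (liftPos s) i) rfl (fun n _ => hE1 hτ n)
      (fun n _ ho => playSeq_succ_adam ho)
    obtain ⟨d', hd'⟩ := exists_playDen A (playSeq A.toPreGame σe (liftPos s) i)
    refine ⟨d', ⟨liftPos s, hτ, fun _ _ _ => rfl, hd'⟩, ?_⟩
    rcases hd' with ⟨j, hj, hlt, rfl⟩ | ⟨hno, hwin, rfl⟩ | ⟨-, -, rfl⟩
    · exact (hq _ _ (sup_prio_le wf (fun n => (hE1 hτ n).1) j)).1 (h2 j hj hlt)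
    · exact absurd hwin (h1 hno).not_of_not
    · exact Or.inl rfl

theorem exists_positional_upLE {M : ℕ} (hM : Even M) {A : PreOPG V} (wf : OPGwf M A) (i : V)
    {σe : List V → V → V} (he : IsEStrat A.toPreGame σe) :
    ∃ σe', IsEStrat A.toPreGame σe' ∧ Positional σe' ∧
      UpLE (denSet A σe i) (denSet A σe' i) := by
  have := wf.finite
  obtain ⟨s₀, hs₀⟩ := Classical.skolem.1 wf.succ
  by_cases hbot : Dom.bot ∈ denSet A σe i
  · exact ⟨liftPos s₀, fun _ v _ => hs₀ v, fun _ _ _ => rfl,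
      fun d _ => ⟨Dom.bot, hbot, Or.inl rfl⟩⟩
  choose q hq using fun o => exists_loop_prio_up hM {m | Dom.ex o m ∈ denSet A σe i} (by
    rintro m ⟨σa, ha, ⟨j, -, -, h⟩ | ⟨-, -, h⟩ | ⟨-, -, h⟩⟩
    · cases h
      exact sup_prio_le wf (playSeq_edge he ha i) j
    · cases h
    · cases h)
  rcases loopWins_or wf.succ (fun v => A.eve v = true) A.Ω Even (· ∈ A.exits) i q with
    ⟨s, hs, hw⟩ | ⟨s, hs, hw⟩
  · have he' : IsEStrat A.toPreGame (liftPos fun v => if v ∈ A.exits then s₀ v else s v) := by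
      intro _ v _
      show A.E v (if v ∈ A.exits then s₀ v else s v)
      split_ifs with hx
      · exact hs₀ v
      · exact hs v hx
    refine ⟨_, he', fun _ _ _ => rfl, ?_⟩
    rintro d ⟨σa, ha, hden⟩
    have hE := playSeq_edge he' ha i
    obtain ⟨h1, h2⟩ := hw _ rfl (fun n _ => hE n)
      (fun n hx ho => (playSeq_succ_eve ho).trans (if_neg hx))
    rcases hden with ⟨j, hj, hlt, rfl⟩ | ⟨-, -, rfl⟩ | ⟨hno, hl, rfl⟩
    · obtain ⟨m', hm', hle⟩ := (hq _ _ (sup_prio_le wf hE j)).1 (h2 j hj hlt)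
      exact ⟨_, hm', domLE_ex_iff.2 ⟨rfl, hle⟩⟩
    · obtain ⟨d', hd'⟩ := exists_playDen A (playSeq A.toPreGame σe (liftPos s₀) i)
      exact ⟨d', ⟨liftPos s₀, fun _ v _ => hs₀ v, hd'⟩, Or.inr (Or.inl rfl)⟩
    · exact absurd (h1 hno) hl
  · exfalso
    have hτ : IsAStrat A.toPreGame (liftPos s) := fun _ v hv =>
      hs v (not_mem_exits_of_adam wf hv)
    have hE := playSeq_edge he hτ i
    obtain ⟨h1, h2⟩ := hw _ rfl (fun n _ => hE n) (fun n _ ho => playSeq_succ_adam ho)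
    obtain ⟨d, hd⟩ := exists_playDen A (playSeq A.toPreGame σe (liftPos s) i)
    have hmem : d ∈ denSet A σe i := ⟨liftPos s, hτ, hd⟩
    rcases hd with ⟨j, hj, hlt, rfl⟩ | ⟨hno, hwin, rfl⟩ | ⟨-, -, rfl⟩
    · exact h2 j hj hlt ((hq _ _ (sup_prio_le wf hE j)).2
        ⟨_, hmem, (domLE_ex_iff.1 (le_refl (α := Dom V) (Dom.ex i _))).2⟩)
    · exact (h1 hno).not_of_not hwin
    · exact hbot hmem

/-- positional determinacy of Pareto fronts. -/
theorem pareto_positional_determinacy {V : Type} (M : ℕ) (hM : Even M) (hM2 : 2 ≤ M)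
    (A : PreOPG V) (wf : OPGwf M A) (i : V) (hi : i ∈ A.ent) :
    pareto A i =
      maxSets { T | ∃ σe, IsEStrat A.toPreGame σe ∧ Positional σe ∧
        T = minSet { d | ∃ σa, IsAStrat A.toPreGame σa ∧ Positional σa ∧
            PlayDen A (playSeq A.toPreGame σe σa i) d } } := by
  have hmin : ∀ σe, IsEStrat A.toPreGame σe → Positional σe →
      minSet (denSet A σe i) = minSet (posDenSet A σe i) := fun σe he hp =>
    minSet_eq_of_subset (fun d ⟨σa, ha, _, hd⟩ => ⟨σa, ha, hd⟩) (upLE_posDenSet hM wf i he hp)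
  have himp : ∀ σe, IsEStrat A.toPreGame σe → ∃ σe', IsEStrat A.toPreGame σe' ∧ Positional σe' ∧
      UpLE (minSet (denSet A σe i)) (minSet (denSet A σe' i)) := by
    intro σe he
    obtain ⟨σe', he', hp', hle⟩ := exists_positional_upLE hM wf i he
    exact ⟨σe', he', hp', ((upLE_minSet_self (denSet_finite wf he i)).trans hle).trans
      fun d hd => ⟨d, hd.1, le_refl (α := Dom V) d⟩⟩
  ext T
  constructor
  · rintro ⟨⟨σe, he, rfl⟩, hmax⟩
    obtain ⟨σe', he', hp', hle⟩ := himp σe he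
    have hge := hmax _ ⟨σe', he', rfl⟩ hle
    refine ⟨⟨σe', he', hp', ?_⟩, ?_⟩
    · exact (Set.Subset.antisymm (minSet_subset_of_upLE hge hle)
        (minSet_subset_of_upLE hle hge)).trans (hmin σe' he' hp')
    · rintro _ ⟨σ, hσ, hpσ, rfl⟩ h
      exact hmax _ ⟨σ, hσ, (hmin σ hσ hpσ).symm⟩ h
  · rintro ⟨⟨σe, he, hp, rfl⟩, hmax⟩
    refine ⟨⟨σe, he, (hmin σe he hp).symm⟩, ?_⟩
    rintro _ ⟨σ, hσ, rfl⟩ h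
    obtain ⟨σ', hσ', hpσ', hle⟩ := himp σ hσ
    exact hle.trans (hmax _ ⟨σ', hσ', hpσ', hmin σ' hσ' hpσ'⟩ (h.trans hle))
end

section
/- Let A be an oPG, i an entrance of A, and σ∃ a positional ∃-strategy. Then positional ∀-strategies suffice against σ∃: Min{ ⟦play(σ∃, σ∀, i)⟧ : σ∀ a ∀-strategy } = Min{ ⟦play(σ∃, σ∀, i)⟧ : σ∀ a positional ∀-strategy }. -/
open scoped Classical

variable {V W : Type}

theorem SubPrio.refl (m : ℕ) : SubPrio m m := by
  rcases Nat.even_or_odd m with h | h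
  · exact Or.inr (Or.inr ⟨h, h, le_rfl⟩)
  · exact Or.inl ⟨h, h, le_rfl⟩

theorem SubPrio.trans {a b c : ℕ} (hab : SubPrio a b) (hbc : SubPrio b c) : SubPrio a c := by
  simp only [SubPrio, Nat.even_iff, Nat.odd_iff] at *
  omega

theorem SubPrio.antisymm {a b : ℕ} (hab : SubPrio a b) (hba : SubPrio b a) : a = b := by
  simp only [SubPrio, Nat.even_iff, Nat.odd_iff] at *
  omega

theorem DomLE.refl (d : Dom V) : DomLE d d := by
  cases d with
  | bot => exact Or.inl rfl
  | top => exact Or.inr (Or.inl rfl)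
  | ex o m => exact Or.inr (Or.inr ⟨o, m, m, rfl, rfl, SubPrio.refl m⟩)

theorem DomLE.trans {a b c : Dom V} (hab : DomLE a b) (hbc : DomLE b c) : DomLE a c := by
  rcases hab with h | rfl | ⟨o, m1, m2, rfl, rfl, h⟩
  · exact Or.inl h
  · rcases hbc with h' | h' | ⟨_, _, _, h', _⟩
    · cases h'
    · exact Or.inr (Or.inl h')
    · cases h'
  · rcases hbc with h' | h' | ⟨_, _, m3, h', rfl, h3⟩
    · cases h'
    · exact Or.inr (Or.inl h')
    · cases h'
      exact Or.inr (Or.inr ⟨o, m1, m3, rfl, rfl, h.trans h3⟩)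

theorem DomLE.antisymm {a b : Dom V} (hab : DomLE a b) (hba : DomLE b a) : a = b := by
  rcases hab with rfl | rfl | ⟨o, m1, m2, rfl, rfl, h⟩
  · rcases hba with h' | h' | ⟨_, _, _, _, h', _⟩
    · exact h'.symm
    · cases h'
    · cases h'
  · rcases hba with h' | h' | ⟨_, _, _, h', _⟩
    · cases h'
    · exact h'
    · cases h'
  · rcases hba with h' | h' | ⟨_, _, _, h1, h2, h3⟩
    · cases h'
    · cases h'
    · cases h1
      cases h2
      rw [h.antisymm h3]

/-- Passing to a coinitial subset does not change the set of minimal elements. -/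
theorem minSet_eq_of_coinitial {T P : Set (Dom V)} (hPT : P ⊆ T)
    (h : ∀ d ∈ T, ∃ d' ∈ P, DomLE d' d) : minSet T = minSet P := by
  ext d
  constructor
  · rintro ⟨hd, hmin⟩
    obtain ⟨d', hd', hle⟩ := h d hd
    obtain rfl := hmin d' (hPT hd') hle
    exact ⟨hd', fun e he => hmin e (hPT he)⟩
  · rintro ⟨hd, hmin⟩
    refine ⟨hPT hd, fun d' hd' hle => ?_⟩
    obtain ⟨e, he, hle'⟩ := h d' hd'
    obtain rfl := hmin e he (hle'.trans hle)
    exact hle.antisymm hle'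

/-! ## Segments of paths -/

/-- The maximal priority on the segment of `p` between the positions `a` and `b`. -/
def segMax (G : PreGame V) (p : ℕ → V) (a b : ℕ) : ℕ :=
  (Finset.Ico a b).sup fun k => G.Ω (p k) (p (k + 1))

theorem segMax_append (G : PreGame V) (p : ℕ → V) {a b c : ℕ} (hab : a ≤ b) (hbc : b ≤ c) :
    segMax G p a c = max (segMax G p a b) (segMax G p b c) := by
  unfold segMax
  rw [← Finset.Ico_union_Ico_eq_Ico hab hbc, Finset.sup_union]

theorem segMax_congr (G : PreGame V) {p q : ℕ → V} {a b : ℕ} (t : ℕ)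
    (h : ∀ k, a ≤ k → k ≤ b → q k = p (k + t)) :
    segMax G q a b = segMax G p (a + t) (b + t) := by
  unfold segMax
  rw [← Finset.image_add_right_Ico, Finset.sup_image]
  refine Finset.sup_congr rfl fun k hk => ?_
  rw [Finset.mem_Ico] at hk
  simp only [Function.comp_apply]
  rw [h k hk.1 hk.2.le, h (k + 1) (by omega) (by omega), add_right_comm]

/-- Removing the closed segment between positions `c` and `d` from a path. -/
def cutPath (p : ℕ → V) (c d : ℕ) (k : ℕ) : V := if k ≤ c then p k else p (k + (d - c))

theorem cutPath_of_le (p : ℕ → V) {c d k : ℕ} (h : k ≤ c) : cutPath p c d k = p k := if_pos h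

theorem cutPath_of_ge {p : ℕ → V} {c d k : ℕ} (hcd : c ≤ d) (hp : p c = p d) (h : c ≤ k) :
    cutPath p c d k = p (k + (d - c)) := by
  unfold cutPath
  split_ifs with hk
  · obtain rfl := le_antisymm h hk
    rw [hp]
    congr 1
    omega
  · rfl

theorem cutPath_step {R : V → V → Prop} {p : ℕ → V} {c d : ℕ} (hcd : c ≤ d) (hp : p c = p d)
    (hR : ∀ k, R (p k) (p (k + 1))) (k : ℕ) : R (cutPath p c d k) (cutPath p c d (k + 1)) := by
  rcases lt_or_ge k c with h | h
  · rw [cutPath_of_le p h.le, cutPath_of_le p h]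
    exact hR k
  · rw [cutPath_of_ge hcd hp h, cutPath_of_ge hcd hp (by omega : c ≤ k + 1), add_right_comm]
    exact hR _

theorem segMax_cutPath (G : PreGame V) {p : ℕ → V} {a b c d : ℕ} (hac : a ≤ c) (hcd : c ≤ d)
    (hdb : d ≤ b) (hp : p c = p d) :
    segMax G (cutPath p c d) a (b - (d - c)) = max (segMax G p a c) (segMax G p d b) := by
  rw [segMax_append G _ hac (by omega : c ≤ b - (d - c)),
    segMax_congr G (q := cutPath p c d) (p := p) 0 fun k _ hk => cutPath_of_le p hk,
    segMax_congr G (q := cutPath p c d) (p := p) (d - c) fun k hk _ => cutPath_of_ge hcd hp hk]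
  congr 2 <;> omega

theorem cutPath_forall_lt {Q : V → Prop} {p : ℕ → V} {b c d : ℕ} (hcd : c ≤ d) (hdb : d ≤ b)
    (hQ : ∀ k < b, Q (p k)) : ∀ k < b - (d - c), Q (cutPath p c d k) := by
  intro k hk
  unfold cutPath
  split_ifs
  · exact hQ _ (by omega)
  · exact hQ _ (by omega)

/-- A positional choice of successors following a path `p` from the last visit to each node
before time `b`. -/
theorem exists_follow {R : V → V → Prop} (hser : ∀ v, ∃ w, R v w) {p : ℕ → V}
    (hR : ∀ k, R (p k) (p (k + 1))) (b : ℕ) :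
    ∃ s : V → V, (∀ v, R v (s v)) ∧
      ∀ k < b, ∃ l, k ≤ l ∧ l < b ∧ p l = p k ∧ s (p k) = p (l + 1) := by
  have key : ∀ v, ∃ w, R v w ∧
      ∀ k < b, p k = v → ∃ l, k ≤ l ∧ l < b ∧ p l = p k ∧ w = p (l + 1) := by
    intro v
    by_cases h : ∃ k, k < b ∧ p k = v
    · obtain ⟨k, hk, hkv⟩ := h
      have hspec := Nat.findGreatest_spec (P := fun k => k < b ∧ p k = v) hk.le ⟨hk, hkv⟩
      set l := Nat.findGreatest (fun k => k < b ∧ p k = v) b with hl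
      refine ⟨p (l + 1), hspec.2 ▸ hR l, fun j hj hjv => ⟨l, ?_, hspec.1, ?_, rfl⟩⟩
      · exact Nat.le_findGreatest hj.le ⟨hj, hjv⟩
      · rw [hspec.2, hjv]
    · obtain ⟨w, hw⟩ := hser v
      exact ⟨w, hw, fun k hk hkv => (h ⟨k, hk, hkv⟩).elim⟩
  choose s hs hs' using key
  exact ⟨s, hs, fun k hk => hs' _ k hk rfl⟩

theorem iterate_follow_of_injOn {s : V → V} {p : ℕ → V} {a b : ℕ}
    (hs : ∀ k < b, ∃ l, k ≤ l ∧ l < b ∧ p l = p k ∧ s (p k) = p (l + 1))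
    (hinj : ∀ c d, a ≤ c → c < d → d < b → p c ≠ p d) :
    ∀ j, a + j ≤ b → s^[j] (p a) = p (a + j) := by
  intro j
  induction j with
  | zero => intro _; rfl
  | succ j ih =>
    intro hj
    obtain ⟨l, hkl, hlb, hpl, hsl⟩ := hs (a + j) (by omega)
    rw [Function.iterate_succ_apply', ih (by omega), hsl]
    rcases hkl.eq_or_lt with rfl | hlt
    · rfl
    · exact (hinj _ _ (by omega) hlt hlb hpl.symm).elim

theorem exists_iterate_follow_eq {s : V → V} {p : ℕ → V} {b : ℕ}
    (hs : ∀ k < b, ∃ l, k ≤ l ∧ l < b ∧ p l = p k ∧ s (p k) = p (l + 1)) (k : ℕ) (hk : k ≤ b) :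
    ∃ n, s^[n] (p k) = p b := by
  induction hr : b - k using Nat.strong_induction_on generalizing k with
  | _ r ih =>
    rcases hk.eq_or_lt with rfl | hlt
    · exact ⟨0, rfl⟩
    · obtain ⟨l, hkl, hlb, -, hsl⟩ := hs k hlt
      obtain ⟨n, hn⟩ := ih (b - (l + 1)) (by omega) (l + 1) hlb rfl
      exact ⟨n + 1, by rw [Function.iterate_succ_apply, hsl, hn]⟩

/-! ## Cycles with odd maximal priority -/

/-- The path `p` closes a cycle between positions `a` and `b` whose maximal priority is odd, and
meets no exit before `b`. -/
structure OddLasso (A : PreOPG V) (R : V → V → Prop) (i : V) (p : ℕ → V) (a b : ℕ) : Prop where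
  start : p 0 = i
  step : ∀ k, R (p k) (p (k + 1))
  lt : a < b
  closed : p a = p b
  odd : Odd (segMax A.toPreGame p a b)
  avoid : ∀ k < b, p k ∉ A.exits

theorem OddLasso.exists_shorter {A : PreOPG V} {R : V → V → Prop} {i : V} {p : ℕ → V} {a b : ℕ}
    (h : OddLasso A R i p a b) {c d : ℕ} (hac : a ≤ c) (hcd : c < d) (hdb : d < b)
    (hp : p c = p d) : ∃ q a' b', OddLasso A R i q a' b' ∧ b' - a' < b - a := by
  by_cases hodd : Odd (segMax A.toPreGame p c d)
  · exact ⟨p, c, d, ⟨h.start, h.step, hcd, hp, hodd, fun k hk => h.avoid k (hk.trans hdb)⟩,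
      by omega⟩
  · refine ⟨cutPath p c d, a, b - (d - c), ⟨?_, cutPath_step hcd.le hp h.step, by omega, ?_, ?_,
      cutPath_forall_lt (Q := (· ∉ A.exits)) hcd.le hdb.le h.avoid⟩, by omega⟩
    · rw [cutPath_of_le p (Nat.zero_le c), h.start]
    · rw [cutPath_of_le p hac, cutPath_of_ge hcd.le hp (by omega), h.closed]
      congr 1
      omega
    · rw [segMax_cutPath _ hac hcd.le hdb.le hp]
      have := h.odd
      rw [segMax_append _ p hac (hcd.le.trans hdb.le), segMax_append _ p hcd.le hdb.le] at this
      simp only [Nat.odd_iff] at *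
      omega

/-- If some path closes an odd cycle, then some positional choice of successors yields a losing
play that meets no exit. -/
theorem OddLasso.exists_positional {A : PreOPG V} {R : V → V → Prop} (hser : ∀ v, ∃ w, R v w)
    {i : V} (h : ∃ p a b, OddLasso A R i p a b) :
    ∃ s : V → V, (∀ v, R v (s v)) ∧ PlayDen A (fun n => s^[n] i) Dom.bot := by
  obtain ⟨p, a, b, hl, hmin⟩ : ∃ p a b, OddLasso A R i p a b ∧
      ∀ q a' b', OddLasso A R i q a' b' → b - a ≤ b' - a' := by
    have h' : ∃ n p a b, OddLasso A R i p a b ∧ b - a = n := by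
      obtain ⟨p, a, b, h⟩ := h
      exact ⟨_, p, a, b, h, rfl⟩
    obtain ⟨p, a, b, hl, hn⟩ := Nat.find_spec h'
    exact ⟨p, a, b, hl, fun q a' b' hq => hn ▸ Nat.find_min' h' ⟨q, a', b', hq, rfl⟩⟩
  have hinj : ∀ c d, a ≤ c → c < d → d < b → p c ≠ p d := by
    intro c d hac hcd hdb hp
    obtain ⟨q, a', b', hq, hlt⟩ := hl.exists_shorter hac hcd hdb hp
    exact absurd (hmin q a' b' hq) (by omega)
  obtain ⟨s, hsR, hs⟩ := exists_follow hser hl.step b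
  refine ⟨s, hsR, Or.inr (Or.inr ⟨?_, ?_, rfl⟩)⟩
  · have hvis : ∀ n, ∃ k < b, s^[n] i = p k := by
      intro n
      induction n with
      | zero => exact ⟨0, by have := hl.lt; omega, hl.start.symm⟩
      | succ n ih =>
        obtain ⟨k, hk, hsk⟩ := ih
        obtain ⟨l, -, hlb, -, hsl⟩ := hs k hk
        rw [Function.iterate_succ_apply', hsk, hsl]
        rcases (Nat.succ_le_of_lt hlb).eq_or_lt with he | hlt
        · exact ⟨a, hl.lt, by rw [hl.closed, ← he]⟩
        · exact ⟨l + 1, hlt, rfl⟩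
    intro n
    obtain ⟨k, hk, hsk⟩ := hvis n
    simp only [hsk]
    exact hl.avoid k hk
  · obtain ⟨N, hN⟩ := exists_iterate_follow_eq hs 0 (Nat.zero_le b)
    rw [hl.start, ← hl.closed] at hN
    have hcyc := iterate_follow_of_injOn hs hinj
    have hab := hl.lt
    have hper : Function.IsPeriodicPt s (b - a) (p a) := by
      have := hcyc (b - a) (by omega)
      rw [show a + (b - a) = b by omega, ← hl.closed] at this
      exact this
    have hpos : ∀ j, s^[N + j] i = p (a + j % (b - a)) := by
      intro j
      have hlt := Nat.mod_lt j (by omega : 0 < b - a)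
      rw [add_comm, Function.iterate_add_apply, hN, ← hper.iterate_mod_apply,
        hcyc _ (by omega)]
    have hpos' : ∀ j, s^[N + j + 1] i = p (a + j % (b - a) + 1) := by
      intro j
      have hlt := Nat.mod_lt j (by omega : 0 < b - a)
      rw [Function.iterate_succ_apply', hpos, ← hcyc _ (by omega),
        ← Function.iterate_succ_apply' s, hcyc _ (by omega)]
      rfl
    rintro ⟨m, hm, hfreq, hmax⟩
    obtain ⟨k, hk, hkeq⟩ := Finset.exists_mem_eq_sup (Finset.Ico a b)
      (Finset.nonempty_Ico.2 hab) fun k => A.Ω (p k) (p (k + 1))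
    rw [Finset.mem_Ico] at hk
    have h1 : segMax A.toPreGame p a b ≤ m := by
      refine hmax _ (Filter.frequently_atTop.2 fun n => ⟨N + ((k - a) + (b - a) * n), ?_, ?_⟩)
      · have : n ≤ (b - a) * n := Nat.le_mul_of_pos_left n (by omega)
        omega
      · simp only [hpos, hpos']
        rw [Nat.add_mul_mod_self_left, Nat.mod_eq_of_lt (by omega),
          show a + (k - a) = k by omega]
        exact hkeq.symm
    have h2 : m ≤ segMax A.toPreGame p a b := by
      obtain ⟨j, hj, hjm⟩ := Filter.frequently_atTop.1 hfreq N
      obtain ⟨j, rfl⟩ := Nat.exists_eq_add_of_le hj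
      simp only [hpos, hpos'] at hjm
      have hlt := Nat.mod_lt j (by omega : 0 < b - a)
      rw [← hjm]
      exact Finset.le_sup (f := fun k => A.Ω (p k) (p (k + 1)))
        (Finset.mem_Ico.2 ⟨by omega, by omega⟩)
    have := hl.odd
    rw [le_antisymm h1 h2] at this
    exact Nat.not_even_iff_odd.2 this hm

theorem Filter.Frequently.exists_fiber {α β : Type*} [Finite β] {l : Filter α} {P : α → Prop}
    (h : ∃ᶠ x in l, P x) (f : α → β) : ∃ y, ∃ᶠ x in l, P x ∧ f x = y := by
  by_contra! hcon
  refine h ?_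
  filter_upwards [Filter.eventually_all.2 hcon] with x hx hP
  exact hx (f x) hP rfl

/-- A losing path in a finite graph closes a cycle with odd maximal priority. -/
theorem exists_odd_cycle [Finite V] {G : PreGame V} {M : ℕ} {p : ℕ → V}
    (hM : ∀ k, G.Ω (p k) (p (k + 1)) ≤ M) (hp : ¬ PlayWins G p) :
    ∃ a b, a < b ∧ p a = p b ∧ Odd (segMax G p a b) := by
  set P : ℕ → Prop := fun m => ∃ᶠ j in Filter.atTop, G.Ω (p j) (p (j + 1)) = m with hP
  have hPM : ∀ m, P m → m ≤ M := by
    intro m hm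
    obtain ⟨j, rfl⟩ := hm.exists
    exact hM j
  obtain ⟨m₀, hm₀⟩ : ∃ m, P m := by
    obtain ⟨y, hy⟩ := Filter.Frequently.exists_fiber (l := Filter.atTop) (P := fun _ : ℕ => True)
      (Filter.frequently_true_iff_neBot _ |>.2 inferInstance)
      fun j => (⟨G.Ω (p j) (p (j + 1)), Nat.lt_succ_of_le (hM j)⟩ : Fin (M + 1))
    refine ⟨y, hy.mono fun j hj => ?_⟩
    rw [← hj.2]
  set m := Nat.findGreatest P M with hm
  have hmP : P m := Nat.findGreatest_spec (hPM _ hm₀) hm₀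
  have hmax : ∀ m', P m' → m' ≤ m := fun m' h => Nat.le_findGreatest (hPM _ h) h
  have hodd : Odd m := by
    rw [← Nat.not_even_iff_odd]
    exact fun he => hp ⟨m, he, hmP, hmax⟩
  obtain ⟨N, hN⟩ : ∃ N, ∀ j ≥ N, G.Ω (p j) (p (j + 1)) ≤ m := by
    by_contra! hcon
    have hfr : ∃ᶠ j in Filter.atTop, m < G.Ω (p j) (p (j + 1)) :=
      Filter.frequently_atTop.2 hcon
    obtain ⟨y, hy⟩ := hfr.exists_fiber
      fun j => (⟨G.Ω (p j) (p (j + 1)), Nat.lt_succ_of_le (hM j)⟩ : Fin (M + 1))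
    have hy' : P y := hy.mono fun j hj => by rw [← hj.2]
    obtain ⟨j, hj, rfl⟩ := hy.exists
    exact absurd (hmax _ hy') (not_le.2 hj)
  obtain ⟨u, hu⟩ := hmP.exists_fiber p
  obtain ⟨a, haN, ham, hau⟩ := Filter.frequently_atTop.1 hu N
  obtain ⟨b, hab, -, hbu⟩ := Filter.frequently_atTop.1 hu (a + 1)
  refine ⟨a, b, hab, hau.trans hbu.symm, ?_⟩
  have : segMax G p a b = m := by
    refine le_antisymm (Finset.sup_le fun k hk => hN k ?_) ?_
    · exact haN.trans (Finset.mem_Ico.1 hk).1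
    · rw [← ham]
      exact Finset.le_sup (f := fun k => G.Ω (p k) (p (k + 1)))
        (Finset.mem_Ico.2 ⟨le_rfl, hab⟩)
  rwa [this]

/-- In the absence of odd cycles, a path to an exit can be replaced by a positional one with a
smaller denotation. -/
theorem exists_positional_exit {A : PreOPG V} {R : V → V → Prop} (hser : ∀ v, ∃ w, R v w)
    {i : V} (hodd : ¬ ∃ p a b, OddLasso A R i p a b) {p : ℕ → V} (hp0 : p 0 = i)
    (hR : ∀ k, R (p k) (p (k + 1))) {n : ℕ} (hn : p n ∈ A.exits)
    (hav : ∀ k < n, p k ∉ A.exits) :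
    ∃ s : V → V, (∀ v, R v (s v)) ∧ ∃ m, SubPrio m (segMax A.toPreGame p 0 n) ∧
      PlayDen A (fun k => s^[k] i) (Dom.ex (p n) m) := by
  have hex : ∃ l, ∃ q : ℕ → V, q 0 = i ∧ (∀ k, R (q k) (q (k + 1))) ∧ q l = p n ∧
      (∀ k < l, q k ∉ A.exits) ∧
      SubPrio (segMax A.toPreGame q 0 l) (segMax A.toPreGame p 0 n) :=
    ⟨n, p, hp0, hR, rfl, hav, SubPrio.refl _⟩
  obtain ⟨q, hq0, hqR, hql, hqav, hqm⟩ := Nat.find_spec hex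
  set l := Nat.find hex with hl
  have hinj : ∀ c d, 0 ≤ c → c < d → d < l → q c ≠ q d := by
    intro c d h0c hcd hdl hq
    have heven : ¬ Odd (segMax A.toPreGame q c d) := fun ho =>
      hodd ⟨q, c, d, hq0, hqR, hcd, hq, ho, fun k hk => hqav k (hk.trans hdl)⟩
    refine Nat.find_min hex (m := l - (d - c)) (by omega) ⟨cutPath q c d, ?_,
      cutPath_step hcd.le hq hqR, ?_, cutPath_forall_lt (Q := (· ∉ A.exits)) hcd.le hdl.le hqav, ?_⟩
    · rw [cutPath_of_le q h0c, hq0]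
    · rw [cutPath_of_ge hcd.le hq (by omega), ← hql]
      congr 1
      omega
    · refine SubPrio.trans ?_ hqm
      rw [segMax_cutPath _ h0c hcd.le hdl.le hq,
        segMax_append _ q h0c (hcd.le.trans hdl.le), segMax_append _ q hcd.le hdl.le]
      simp only [SubPrio, Nat.odd_iff, Nat.even_iff] at *
      omega
  obtain ⟨s, hsR, hs⟩ := exists_follow hser hqR l
  have hit : ∀ j ≤ l, s^[j] i = q j := by
    intro j hj
    have := iterate_follow_of_injOn hs hinj j (by omega)
    rwa [hq0, zero_add] at this
  refine ⟨s, hsR, _, hqm, Or.inl ⟨l, ?_, ?_, ?_⟩⟩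
  · simpa only [hit l le_rfl, hql] using hn
  · intro k hk
    simpa only [hit k hk.le] using hqav k hk
  · simp only [hit l le_rfl, hql]
    rw [segMax, ← Finset.range_eq_Ico]
    congr 1
    refine Finset.sup_congr rfl fun k hk => ?_
    rw [Finset.mem_range] at hk
    rw [hit k hk.le, hit (k + 1) hk]

theorem playSeq_succ (G : PreGame V) (σe σa : List V → V → V) (v : V) (n : ℕ) :
    playSeq G σe σa v (n + 1) = if G.eve (playSeq G σe σa v n) then
      σe (playPath G σe σa v n).1 (playSeq G σe σa v n)
      else σa (playPath G σe σa v n).1 (playSeq G σe σa v n) := rfl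

/-- against a positional ∃-strategy, positional ∀-strategies suffice. -/
theorem positional_forall_suffice {V : Type} (M : ℕ) (hM : Even M) (hM2 : 2 ≤ M)
    (A : PreOPG V) (wf : OPGwf M A) (i : V) (hi : i ∈ A.ent)
    (σe : List V → V → V) (hE : IsEStrat A.toPreGame σe) (hpos : Positional σe) :
    minSet (denSet A σe i) =
      minSet { d | ∃ σa, IsAStrat A.toPreGame σa ∧ Positional σa ∧
          PlayDen A (playSeq A.toPreGame σe σa i) d } := by
  have := wf.finite
  set R : V → V → Prop := fun v w => A.E v w ∧ (A.eve v = true → w = σe [] v) with hRdef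
  have hser : ∀ v, ∃ w, R v w := by
    intro v
    by_cases hv : A.eve v = true
    · exact ⟨σe [] v, hE [] v hv, fun _ => rfl⟩
    · obtain ⟨w, hw⟩ := wf.succ v
      exact ⟨w, hw, fun h => (hv h).elim⟩
  have hplay : ∀ s : V → V, (∀ v, R v (s v)) →
      playSeq A.toPreGame σe (liftPos s) i = fun n => s^[n] i := by
    intro s hs
    funext n
    induction n with
    | zero => rfl
    | succ n ih =>
      rw [playSeq_succ, ih, Function.iterate_succ_apply']
      split_ifs with hv
      · rw [(hs _).2 hv]
        exact hpos _ _ _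
      · rfl
  refine minSet_eq_of_coinitial (fun d ⟨σa, hσ, _, hd⟩ => ⟨σa, hσ, hd⟩) ?_
  suffices hmain : ∀ d ∈ denSet A σe i, ∃ s : V → V, (∀ v, R v (s v)) ∧
      ∃ d', DomLE d' d ∧ PlayDen A (fun n => s^[n] i) d' by
    intro d hd
    obtain ⟨s, hs, d', hle, hd'⟩ := hmain d hd
    refine ⟨d', ⟨liftPos s, fun _ v _ => (hs v).1, fun _ _ _ => rfl, ?_⟩, hle⟩
    rwa [hplay s hs]
  rintro d ⟨σa, hA, hd⟩
  by_cases hodd : ∃ p a b, OddLasso A R i p a b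
  · obtain ⟨s, hs, hbot⟩ := OddLasso.exists_positional hser hodd
    exact ⟨s, hs, _, Or.inl rfl, hbot⟩
  set p := playSeq A.toPreGame σe σa i with hp
  have hstep : ∀ k, R (p k) (p (k + 1)) := by
    intro k
    rw [hp, playSeq_succ, ← hp]
    split_ifs with hv
    · exact ⟨hE _ _ hv, fun _ => hpos _ _ _⟩
    · exact ⟨hA _ _ (by simpa using hv), fun h => (hv h).elim⟩
  rcases hd with ⟨j, hj, hav, rfl⟩ | ⟨-, -, rfl⟩ | ⟨hav, hlose, rfl⟩
  · obtain ⟨s, hs, m, hm, hden⟩ := exists_positional_exit hser hodd rfl hstep hj hav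
    rw [segMax, ← Finset.range_eq_Ico] at hm
    exact ⟨s, hs, _, Or.inr (Or.inr ⟨_, _, _, rfl, rfl, hm⟩), hden⟩
  · choose s hs using hser
    obtain ⟨d', hd'⟩ := exists_playDen A fun n => s^[n] i
    exact ⟨s, hs, d', Or.inr (Or.inl rfl), hd'⟩
  · obtain ⟨a, b, hab, hclosed, ho⟩ :=
      exists_odd_cycle (fun k => wf.prio_le _ _ (hstep k).1) hlose
    exact (hodd ⟨p, a, b, rfl, hstep, hab, hclosed, ho, fun k _ => hav k⟩).elim
end

section
/- For all priorities m, m' ∈ ℙ, the maximum max(m, m') (with respect to the usual order on natural numbers) is even if and only if m† ⪯_P m'. -/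
open scoped Classical

variable {V W : Type}

/-- `max(m, m')` is even iff `m† ⪯_P m'`. -/
theorem max_even_iff_dual_subPrio (M : ℕ) (hM : Even M) (hM2 : 2 ≤ M)
    (m m' : ℕ) (h1 : m ≤ M) (h2 : m' ≤ M) :
    Even (max m m') ↔ SubPrio (dualP m) m' := by
  simp only [SubPrio, dualP, Nat.even_iff, Nat.odd_iff]
  split_ifs <;> omega
end
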